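/- Let J be the superalgebra (2,2)₁. For every even supersymmetric 2-cocycle h : J × J → J there exists an even F-linear map μ : J → J with h(a,b) = aμ(b) + μ(a)b − μ(ab) for all a, b; that is, the even part of the second cohomology group H²(J,J) vanishes. -/

import Mathlib

namespace JS22

variable (F : Type*) [Field F] [CharZero F]

/-- The underlying ℤ₂-graded vector space `J = F⁴`: coordinates `0,1` are the even
basis vectors `e₁, e₂` and coordinates `2,3` are the odd basis vectors `f₁, f₂`. -/
abbrev J : Type _ := Fin 4 → F

def e1 : J F := ![1, 0, 0, 0]
def e2 : J F := ![0, 1, 0, 0]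
def f1 : J F := ![0, 0, 1, 0]
def f2 : J F := ![0, 0, 0, 1]

/-- The even part `J₀ = span {e₁, e₂}`. -/
def J0 : Submodule F (J F) := Submodule.span F {e1 F, e2 F}

/-- The odd part `J₁ = span {f₁, f₂}`. -/
def J1 : Submodule F (J F) := Submodule.span F {f1 F, f2 F}

/-- `x` is homogeneous of degree `d ∈ {0, 1}`. -/
def IsHomog (x : J F) (d : ℕ) : Prop :=
  (d = 0 ∧ x ∈ J0 F) ∨ (d = 1 ∧ x ∈ J1 F)

/-- A (bilinear) multiplication is supercommutative: `x y = (−1)^{|x||y|} y x`. -/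
def IsSuperComm (mul : J F → J F → J F) : Prop :=
  ∀ x y : J F, ∀ dx dy : ℕ, IsHomog F x dx → IsHomog F y dy →
    mul x y = ((-1 : F) ^ (dx * dy)) • mul y x

/-- The Jordan superidentity, for all homogeneous `w, x, y, z`. -/
def SatisfiesJordanSuperId (mul : J F → J F → J F) : Prop :=
  ∀ w x y z : J F, ∀ dw dx dy dz : ℕ,
    IsHomog F w dw → IsHomog F x dx → IsHomog F y dy → IsHomog F z dz →
    mul (mul w x) (mul y z)
      + ((-1 : F) ^ (dx * dy)) • mul (mul w y) (mul x z)
      + ((-1 : F) ^ ((dx + dy) * dz)) • mul (mul w z) (mul x y)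
      - ((-1 : F) ^ (dw * dx)) • mul x (mul w (mul y z))
      - ((-1 : F) ^ (dy * (dw + dx))) • mul y (mul w (mul x z))
      - ((-1 : F) ^ (dz * (dw + dx + dy))) • mul z (mul w (mul x y)) = 0

/-- `F(a,b,c,d) = h((ab)c, d) + h(ab,c)·d + (h(a,b)·c)·d`. -/
def Fc (mul : J F → J F → J F) (h : J F →ₗ[F] J F →ₗ[F] J F) (a b c d : J F) : J F :=
  h (mul (mul a b) c) d + mul (h (mul a b) c) d + mul (mul (h a b) c) d

/-- `G(a,b,c,d) = h(ab, cd) + h(a,b)·(cd) + (ab)·h(c,d)`. -/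
def Gc (mul : J F → J F → J F) (h : J F →ₗ[F] J F →ₗ[F] J F) (a b c d : J F) : J F :=
  h (mul a b) (mul c d) + mul (h a b) (mul c d) + mul (mul a b) (h c d)

/-- Supersymmetry of `h`: `h(a,b) = (−1)^{|a||b|} h(b,a)` for homogeneous `a, b`. -/
def IsSuperSym (h : J F →ₗ[F] J F →ₗ[F] J F) : Prop :=
  ∀ a b : J F, ∀ da db : ℕ, IsHomog F a da → IsHomog F b db →
    h a b = ((-1 : F) ^ (da * db)) • h b a

/-- The 2-cocycle identity for `h` with respect to the multiplication `mul`. -/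
def IsCocycleId (mul : J F → J F → J F) (h : J F →ₗ[F] J F →ₗ[F] J F) : Prop :=
  ∀ a b c d : J F, ∀ da db dc dd : ℕ,
    IsHomog F a da → IsHomog F b db → IsHomog F c dc → IsHomog F d dd →
    Fc F mul h a b c d + ((-1 : F) ^ (db * (dc + dd) + dc * dd)) • Fc F mul h a d c b
      + ((-1 : F) ^ (da * (db + dc + dd) + dc * dd)) • Fc F mul h b d c a
    = Gc F mul h a b c d + ((-1 : F) ^ (db * dc)) • Gc F mul h a c b d
      + ((-1 : F) ^ (dd * (dc + db))) • Gc F mul h a d b c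

/-- `h` is a supersymmetric 2-cocycle. -/
def IsSuperCocycle (mul : J F → J F → J F) (h : J F →ₗ[F] J F →ₗ[F] J F) : Prop :=
  IsSuperSym F h ∧ IsCocycleId F mul h

/-- `h` is a coboundary: `h(a,b) = a·μ(b) + μ(a)·b − μ(a·b)` for some linear `μ`. -/
def IsCoboundary (mul : J F → J F → J F) (h : J F →ₗ[F] J F →ₗ[F] J F) : Prop :=
  ∃ μ : J F →ₗ[F] J F, ∀ a b : J F, h a b = mul a (μ b) + mul (μ a) b - μ (mul a b)

/-- The bilinear map `h` is even: `h(J_i × J_j) ⊆ J_{i+j}`. -/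
def IsEvenBilin (h : J F →ₗ[F] J F →ₗ[F] J F) : Prop :=
  (∀ a ∈ J0 F, ∀ b ∈ J0 F, h a b ∈ J0 F) ∧
  (∀ a ∈ J0 F, ∀ b ∈ J1 F, h a b ∈ J1 F) ∧
  (∀ a ∈ J1 F, ∀ b ∈ J0 F, h a b ∈ J1 F) ∧
  (∀ a ∈ J1 F, ∀ b ∈ J1 F, h a b ∈ J0 F)

/-- The linear map `μ` is even: `μ(J_i) ⊆ J_i`. -/
def IsEvenLin (μ : J F →ₗ[F] J F) : Prop :=
  (∀ a ∈ J0 F, μ a ∈ J0 F) ∧ (∀ a ∈ J1 F, μ a ∈ J1 F)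

/-- `φ` is a graded algebra isomorphism from `(J, mulA)` onto `(J, mulB)`. -/
def IsGradedIso (mulA mulB : J F → J F → J F) (φ : J F → J F) : Prop :=
  IsLinearMap F φ ∧ Function.Bijective φ ∧
  φ '' (J0 F : Set (J F)) = (J0 F : Set (J F)) ∧
  φ '' (J1 F : Set (J F)) = (J1 F : Set (J F)) ∧
  ∀ x y : J F, φ (mulA x y) = mulB (φ x) (φ y)

/-- `D_γ`: `e₁²=e₁`, `e₂²=e₂`, `eᵢfⱼ = ½fⱼ`, `f₁f₂ = e₁ + γe₂`. -/
def mulD (γ : F) (x y : J F) : J F :=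
  ![x 0 * y 0 + (x 2 * y 3 - x 3 * y 2),
    x 1 * y 1 + γ * (x 2 * y 3 - x 3 * y 2),
    ((x 0 + x 1) * y 2 + x 2 * (y 0 + y 1)) / 2,
    ((x 0 + x 1) * y 3 + x 3 * (y 0 + y 1)) / 2]

/-- `(2,2)₁`: `e₁²=e₁`, `e₂²=e₂`. -/
def mul1 (x y : J F) : J F :=
  ![x 0 * y 0, x 1 * y 1, 0, 0]

/-- `(2,2)₃`: `e₁²=e₁`, `e₂²=e₂`, `e₁f₁=½f₁`, `e₁f₂=½f₂`, `f₁f₂=e₁`. -/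
def mul3 (x y : J F) : J F :=
  ![x 0 * y 0 + (x 2 * y 3 - x 3 * y 2), x 1 * y 1,
    (x 0 * y 2 + x 2 * y 0) / 2, (x 0 * y 3 + x 3 * y 0) / 2]

/-- `(2,2)₅`: `e₁²=e₁`, `e₂²=e₂`, `e₁f₁=f₁`, `e₁f₂=f₂`, `f₁f₂=e₁`. -/
def mul5 (x y : J F) : J F :=
  ![x 0 * y 0 + (x 2 * y 3 - x 3 * y 2), x 1 * y 1,
    x 0 * y 2 + x 2 * y 0, x 0 * y 3 + x 3 * y 0]

/-- `(2,2)₇`: `e₁²=e₁`, `e₂²=e₂`, `eᵢfⱼ=½fⱼ`, `f₁f₂=e₂`. -/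
def mul7 (x y : J F) : J F :=
  ![x 0 * y 0, x 1 * y 1 + (x 2 * y 3 - x 3 * y 2),
    ((x 0 + x 1) * y 2 + x 2 * (y 0 + y 1)) / 2,
    ((x 0 + x 1) * y 3 + x 3 * (y 0 + y 1)) / 2]

/-- `(2,2)₈`: `e₁²=e₁`, `e₂²=e₂`, `e₁f₁=½f₁`. -/
def mul8 (x y : J F) : J F :=
  ![x 0 * y 0, x 1 * y 1, (x 0 * y 2 + x 2 * y 0) / 2, 0]

/-- `(2,2)₂₆`: `e₁²=e₁`, `e₁f₁=½f₁`, `e₁f₂=½f₂`, `f₁f₂=e₁+e₂`. -/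
def mul26 (x y : J F) : J F :=
  ![x 0 * y 0 + (x 2 * y 3 - x 3 * y 2), x 2 * y 3 - x 3 * y 2,
    (x 0 * y 2 + x 2 * y 0) / 2, (x 0 * y 3 + x 3 * y 0) / 2]

/-- `(2,2)₄₃`: `e₁²=e₁`, `e₁e₂=e₂`, `e₁f₁=f₁`, `e₁f₂=f₂`, `f₁f₂=e₁+e₂`. -/
def mul43 (x y : J F) : J F :=
  ![x 0 * y 0 + (x 2 * y 3 - x 3 * y 2),
    x 0 * y 1 + x 1 * y 0 + (x 2 * y 3 - x 3 * y 2),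
    x 0 * y 2 + x 2 * y 0, x 0 * y 3 + x 3 * y 0]

/-- `(2,2)₅₂`: `e₁²=e₁`, `e₁e₂=½e₂`. -/
def mul52 (x y : J F) : J F :=
  ![x 0 * y 0, (x 0 * y 1 + x 1 * y 0) / 2, 0, 0]

/-- `(2,2)₅₇`: `e₁²=e₁`, `e₁e₂=½e₂`, `e₁f₂=f₂`. -/
def mul57 (x y : J F) : J F :=
  ![x 0 * y 0, (x 0 * y 1 + x 1 * y 0) / 2, 0, x 0 * y 3 + x 3 * y 0]

/-- `(2,2)₆₀`: `e₁²=e₁`, `e₁e₂=½e₂`, `e₁f₁=½f₁`, `e₁f₂=½f₂`. -/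
def mul60 (x y : J F) : J F :=
  ![x 0 * y 0, (x 0 * y 1 + x 1 * y 0) / 2,
    (x 0 * y 2 + x 2 * y 0) / 2, (x 0 * y 3 + x 3 * y 0) / 2]

/-- `(2,2)₆₇`: `e₁²=e₁`, `e₁e₂=½e₂`, `e₁f₁=f₁`, `e₁f₂=f₂`. -/
def mul67 (x y : J F) : J F :=
  ![x 0 * y 0, (x 0 * y 1 + x 1 * y 0) / 2,
    x 0 * y 2 + x 2 * y 0, x 0 * y 3 + x 3 * y 0]


theorem mem_J0_iff (x : J F) : x ∈ J0 F ↔ x 2 = 0 ∧ x 3 = 0 := by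
  unfold J0 e1 e2
  rw [Submodule.mem_span_pair]
  constructor
  · rintro ⟨a, b, rfl⟩
    simp
  · rintro ⟨h2, h3⟩
    refine ⟨x 0, x 1, ?_⟩
    ext i
    fin_cases i <;> simp [h2, h3]

theorem mem_J1_iff (x : J F) : x ∈ J1 F ↔ x 0 = 0 ∧ x 1 = 0 := by
  unfold J1 f1 f2
  rw [Submodule.mem_span_pair]
  constructor
  · rintro ⟨a, b, rfl⟩
    simp
  · rintro ⟨h2, h3⟩
    refine ⟨x 2, x 3, ?_⟩
    ext i
    fin_cases i <;> simp [h2, h3]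

theorem e1_mem : e1 F ∈ J0 F := Submodule.subset_span (by simp)
theorem e2_mem : e2 F ∈ J0 F := Submodule.subset_span (by simp)
theorem f1_mem : f1 F ∈ J1 F := Submodule.subset_span (by simp)
theorem f2_mem : f2 F ∈ J1 F := Submodule.subset_span (by simp)

theorem decomp (x : J F) :
    x = x 0 • e1 F + x 1 • e2 F + x 2 • f1 F + x 3 • f2 F := by
  ext i
  fin_cases i <;> simp [e1, e2, f1, f2]

theorem m11 : mul1 F (e1 F) (e1 F) = e1 F := by
  ext i; fin_cases i <;> simp [mul1, e1]
theorem m22 : mul1 F (e2 F) (e2 F) = e2 F := by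
  ext i; fin_cases i <;> simp [mul1, e2]
theorem m12 : mul1 F (e1 F) (e2 F) = 0 := by
  ext i; fin_cases i <;> simp [mul1, e1, e2]
theorem m21 : mul1 F (e2 F) (e1 F) = 0 := by
  ext i; fin_cases i <;> simp [mul1, e1, e2]
theorem mJ1 (x y : J F) (hx : x ∈ J1 F) : mul1 F x y = 0 := by
  rw [mem_J1_iff] at hx
  ext i; fin_cases i <;> simp [mul1, hx]
theorem mJ1' (x y : J F) (hx : x ∈ J1 F) : mul1 F y x = 0 := by
  rw [mem_J1_iff] at hx
  ext i; fin_cases i <;> simp [mul1, hx]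
theorem mz (x : J F) : mul1 F x 0 = 0 := mJ1' F _ _ (Submodule.zero_mem _)
theorem zm (x : J F) : mul1 F 0 x = 0 := mJ1 F _ _ (Submodule.zero_mem _)

/-- An idempotent even element kills odd elements under an even cocycle. -/
theorem h_even_odd (h : J F →ₗ[F] J F →ₗ[F] J F)
    (hev : IsEvenBilin F h) (hc : IsSuperCocycle F (mul1 F) h)
    (e f : J F) (he : e ∈ J0 F) (hf : f ∈ J1 F) (hee : mul1 F e e = e) : h e f = 0 := by
  have k := hc.2 e e e f 0 0 0 1 (.inl ⟨rfl, he⟩) (.inl ⟨rfl, he⟩) (.inl ⟨rfl, he⟩)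
    (.inr ⟨rfl, hf⟩)
  have h1 := hev.2.1 e he f hf
  simpa [Fc, Gc, hee, mJ1 F _ _ hf, mJ1' F _ _ hf, mJ1 F _ _ h1, mJ1' F _ _ h1, mz, zm] using k

/-- The idempotent component of the product of odd elements vanishes. -/
theorem h_odd_odd (h : J F →ₗ[F] J F →ₗ[F] J F)
    (hev : IsEvenBilin F h) (hc : IsSuperCocycle F (mul1 F) h)
    (e f g : J F) (he : e ∈ J0 F) (hf : f ∈ J1 F) (hg : g ∈ J1 F) (hee : mul1 F e e = e) :
    mul1 F e (h f g) = 0 := by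
  have k := hc.2 e f g e 0 1 1 0 (.inl ⟨rfl, he⟩) (.inr ⟨rfl, hf⟩) (.inr ⟨rfl, hg⟩)
    (.inl ⟨rfl, he⟩)
  have h1 := h_even_odd F h hev hc e f he hf hee
  have h2 := h_even_odd F h hev hc e g he hg hee
  have h3 : h f e = 0 := by
    rw [hc.1 f e 1 0 (.inr ⟨rfl, hf⟩) (.inl ⟨rfl, he⟩), h1, smul_zero]
  simpa [Fc, Gc, hee, mJ1 F _ _ hf, mJ1' F _ _ hf, mJ1 F _ _ hg, mJ1' F _ _ hg, h1, h2, h3,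
    mz, zm, eq_comm] using k

theorem h_ee (h : J F →ₗ[F] J F →ₗ[F] J F) (hc : IsSuperCocycle F (mul1 F) h)
    (e e' : J F) (he : e ∈ J0 F) (he' : e' ∈ J0 F) (hee : mul1 F e e = e)
    (h12 : mul1 F e e' = 0) :
    h e e' + mul1 F (h e e) e' + mul1 F (mul1 F (h e e) e) e'
      + mul1 F (mul1 F (h e e') e) e + mul1 F (mul1 F (h e e') e) e
      = mul1 F e (h e e') + mul1 F e (h e e') + mul1 F (h e e') e := by
  have k := hc.2 e e e e' 0 0 0 0 (.inl ⟨rfl, he⟩) (.inl ⟨rfl, he⟩) (.inl ⟨rfl, he⟩)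
    (.inl ⟨rfl, he'⟩)
  simpa [Fc, Gc, hee, h12, mz, zm, add_assoc] using k

/-- for `J = (2,2)₁`, every even supersymmetric 2-cocycle is the
coboundary of an even linear map, i.e. the even part of `H²(J,J)` vanishes. -/
theorem even_H2_vanishes_mul1 (h : J F →ₗ[F] J F →ₗ[F] J F)
    (hev : IsEvenBilin F h) (hc : IsSuperCocycle F (mul1 F) h) :
    ∃ μ : J F →ₗ[F] J F, IsEvenLin F μ ∧
      ∀ a b : J F, h a b = mul1 F a (μ b) + mul1 F (μ a) b - μ (mul1 F a b) := by
  have hA := h_ee F h hc _ _ (e1_mem F) (e2_mem F) (m11 F) (m12 F)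
  have hB := h_ee F h hc _ _ (e2_mem F) (e1_mem F) (m22 F) (m21 F)
  have hs : h (e2 F) (e1 F) = h (e1 F) (e2 F) := by
    simpa using hc.1 _ _ 0 0 (.inl ⟨rfl, e2_mem F⟩) (.inl ⟨rfl, e1_mem F⟩)
  rw [hs] at hB
  have heo : ∀ f ∈ J1 F, h (e1 F) f = 0 ∧ h (e2 F) f = 0 ∧ h f (e1 F) = 0 ∧ h f (e2 F) = 0 := by
    intro f hf
    have a := h_even_odd F h hev hc _ f (e1_mem F) hf (m11 F)
    have b := h_even_odd F h hev hc _ f (e2_mem F) hf (m22 F)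
    refine ⟨a, b, ?_, ?_⟩
    · rw [hc.1 f _ 1 0 (.inr ⟨rfl, hf⟩) (.inl ⟨rfl, e1_mem F⟩), a, smul_zero]
    · rw [hc.1 f _ 1 0 (.inr ⟨rfl, hf⟩) (.inl ⟨rfl, e2_mem F⟩), b, smul_zero]
  have hoo : ∀ f ∈ J1 F, ∀ g ∈ J1 F, h f g = 0 := by
    intro f hf g hg
    have a := congrFun (h_odd_odd F h hev hc _ f g (e1_mem F) hf hg (m11 F)) 0
    have b := congrFun (h_odd_odd F h hev hc _ f g (e2_mem F) hf hg (m22 F)) 1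
    have c := (mem_J0_iff F _).1 (hev.2.2.2 f hf g hg)
    simp [mul1, e1, e2] at a b
    ext i
    fin_cases i <;> simp [a, b, c]
  have d11 := (mem_J0_iff F _).1 (hev.1 _ (e1_mem F) _ (e1_mem F))
  have d12 := (mem_J0_iff F _).1 (hev.1 _ (e1_mem F) _ (e2_mem F))
  have d22 := (mem_J0_iff F _).1 (hev.1 _ (e2_mem F) _ (e2_mem F))
  obtain ⟨o1, o2, o3, o4⟩ := heo _ (f1_mem F)
  obtain ⟨p1, p2, p3, p4⟩ := heo _ (f2_mem F)
  have q1 := hoo _ (f1_mem F) _ (f1_mem F)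
  have q2 := hoo _ (f1_mem F) _ (f2_mem F)
  have q3 := hoo _ (f2_mem F) _ (f1_mem F)
  have q4 := hoo _ (f2_mem F) _ (f2_mem F)
  have hexp : ∀ a b : J F, h a b = (a 0 * b 0) • h (e1 F) (e1 F)
      + (a 0 * b 1 + a 1 * b 0) • h (e1 F) (e2 F) + (a 1 * b 1) • h (e2 F) (e2 F) := by
    intro a b
    conv_lhs => rw [decomp F a, decomp F b]
    simp only [map_add, map_smul, LinearMap.add_apply, LinearMap.smul_apply, o1, o2, o3, o4,
      p1, p2, p3, p4, q1, q2, q3, q4, hs]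
    module
  generalize h (e1 F) (e1 F) = u at *
  generalize h (e1 F) (e2 F) = v at *
  generalize h (e2 F) (e2 F) = w at *
  have hA1 : v 1 + u 1 = 0 := by
    have := congrFun hA 1
    simpa [mul1, e1, e2, Matrix.vecHead, Matrix.vecTail] using this
  have hB0 : v 0 + w 0 = 0 := by
    have := congrFun hB 0
    simpa [mul1, e1, e2, Matrix.vecHead, Matrix.vecTail] using this
  refine ⟨Matrix.mulVecLin !![u 0, v 0, 0, 0; v 1, w 1, 0, 0; 0, 0, 0, 0; 0, 0, 0, 0],
    ⟨?_, ?_⟩, ?_⟩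
  · intro a _
    rw [mem_J0_iff]
    simp [Matrix.mulVec, dotProduct, Fin.sum_univ_four]
  · intro a ha
    rw [mem_J1_iff] at ha ⊢
    simp [Matrix.mulVec, dotProduct, Fin.sum_univ_four, ha]
  · intro a b
    rw [hexp]
    ext i
    fin_cases i <;> simp [Matrix.mulVec, dotProduct, Fin.sum_univ_four, mul1, d11, d12, d22]
    · linear_combination (a 1 * b 1) * hB0
    · linear_combination (a 0 * b 0) * hA1

end JS22
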